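/- Let U ⊆ ℝ³ be a contractible open set and let c, d : U → ℝ be smooth functions satisfying X³d + (XY + Z)c = 0 and Y²c + (YX² − ZX + W)d = 0 on U. Then there exist smooth functions a, b : U → ℝ such that c = X³b − (X²Y + XZ + W)a and d = Y²a − (YX − Z)b on U (i.e. the Martinet complex is locally exact in degree two). -/

import Mathlib

/-- Martinet operator `X = ∂/∂x` on `ℝ³` with coordinates `(x, y, z)`. -/
noncomputable def opX (f : (Fin 3 → ℝ) → ℝ) : (Fin 3 → ℝ) → ℝ :=
  fun p => fderiv ℝ f p ![1, 0, 0]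

/-- Martinet operator `Y = ∂/∂z + x² ∂/∂y` on `ℝ³`. -/
noncomputable def opY (f : (Fin 3 → ℝ) → ℝ) : (Fin 3 → ℝ) → ℝ :=
  fun p => fderiv ℝ f p ![0, (p 0) ^ 2, 1]

/-- Martinet operator `Z = [X, Y] = 2x ∂/∂y` on `ℝ³`. -/
noncomputable def opZ (f : (Fin 3 → ℝ) → ℝ) : (Fin 3 → ℝ) → ℝ :=
  fun p => fderiv ℝ f p ![0, 2 * p 0, 0]

/-- Martinet operator `W = [X, Z] = 2 ∂/∂y` on `ℝ³`. -/
noncomputable def opW (f : (Fin 3 → ℝ) → ℝ) : (Fin 3 → ℝ) → ℝ :=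
  fun p => fderiv ℝ f p ![0, 2, 0]

open Set Metric
open scoped ContDiff Manifold Topology

theorem exists_continuous_radius {X : Type*} [MetricSpace X] {U : Set X} (hU : IsOpen U) :
    ∃ δ : X → ℝ, Continuous δ ∧ ∀ x ∈ U, 0 < δ x ∧ ball x (δ x) ⊆ U := by
  rcases Uᶜ.eq_empty_or_nonempty with h | h
  · refine ⟨fun _ => 1, continuous_const, fun x _ => ⟨one_pos, ?_⟩⟩
    rw [compl_empty_iff.mp h]
    exact subset_univ _
  · refine ⟨fun x => infDist x Uᶜ, continuous_infDist_pt _, fun x hx => ⟨?_, ?_⟩⟩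
    · exact (hU.isClosed_compl.notMem_iff_infDist_pos h).mp (by simpa using hx)
    · simpa using ball_infDist_compl_subset (s := U) (x := x)

theorem exists_contDiffOn_contraction {E : Type*} [NormedAddCommGroup E] [NormedSpace ℝ E]
    [FiniteDimensional ℝ E] {U : Set E} (hU : IsOpen U) (hUc : ContractibleSpace U) :
    ∃ F : ℝ × E → E, ∃ q : E, ContDiffOn ℝ ∞ F (univ ×ˢ U) ∧ MapsTo F (univ ×ˢ U) U ∧
      (∀ x ∈ U, F (0, x) = x) ∧ ∀ x ∈ U, F (1, x) = q := by
  obtain ⟨q, ⟨h⟩⟩ := id_nullhomotopic U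
  let V : TopologicalSpace.Opens (ℝ × E) := ⟨univ ×ˢ U, isOpen_univ.prod hU⟩
  have hV : ∀ v : V, v.1.2 ∈ U := fun v => v.2.2
  let H : V → E := fun v => h (projIcc 0 1 zero_le_one (3 * v.1.1 - 1), ⟨v.1.2, hV v⟩)
  have hHc : Continuous H := by
    refine continuous_subtype_val.comp (h.continuous.comp (Continuous.prodMk ?_ ?_))
    · exact continuous_projIcc.comp (by fun_prop)
    · exact Continuous.subtype_mk (by fun_prop) _
  have hHU : ∀ v, H v ∈ U := fun v => Subtype.coe_prop _
  have hH0 : ∀ v : V, v.1.1 < 1 / 3 → H v = v.1.2 := fun v hv => by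
    simp [H, projIcc_of_le_left zero_le_one (show 3 * v.1.1 - 1 ≤ 0 by linarith)]
  have hH1 : ∀ v : V, 2 / 3 < v.1.1 → H v = q := fun v hv => by
    simp [H, projIcc_of_right_le zero_le_one (show 1 ≤ 3 * v.1.1 - 1 by linarith)]
  obtain ⟨δ, hδc, hδ⟩ := exists_continuous_radius hU
  have hfst : Continuous fun v : V => v.1.1 := by fun_prop
  have hS : IsClosed {v : V | v.1.1 ≤ 0 ∨ 1 ≤ v.1.1} :=
    (isClosed_le hfst continuous_const).union (isClosed_le continuous_const hfst)
  have hO0 : IsOpen {v : V | v.1.1 < 1 / 3} := isOpen_lt hfst continuous_const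
  have hO1 : IsOpen {v : V | 2 / 3 < v.1.1} := isOpen_lt continuous_const hfst
  have hO : {v : V | v.1.1 < 1 / 3} ∪ {v : V | 2 / 3 < v.1.1} ∈
      𝓝ˢ {v : V | v.1.1 ≤ 0 ∨ 1 ≤ v.1.1} := by
    refine (hO0.union hO1).mem_nhdsSet.mpr ?_
    rintro v (hv | hv)
    · left; show v.1.1 < 1 / 3; linarith
    · right; show 2 / 3 < v.1.1; linarith
  have hsm : ContMDiffOn 𝓘(ℝ, ℝ × E) 𝓘(ℝ, E) ((⊤ : ℕ∞) : WithTop ℕ∞) H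
      ({v : V | v.1.1 < 1 / 3} ∪ {v : V | 2 / 3 < v.1.1}) := by
    refine ContMDiffOn.union_of_isOpen ?_ ?_ hO0 hO1
    · refine ContMDiffOn.congr (f := fun v : V => v.1.2) ?_ hH0
      exact (contDiff_snd.contMDiff.comp contMDiff_subtype_val).contMDiffOn
    · exact contMDiffOn_const.congr hH1
  have : LocallyCompactSpace V := V.isOpen.locallyCompactSpace
  obtain ⟨g, hg, hgS, -⟩ := hHc.exists_contMDiff_approx_and_eqOn 𝓘(ℝ, ℝ × E) ⊤
    (hδc.comp hHc) (fun v => (hδ _ (hHU v)).1) hS hO hsm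
  classical
  let F : ℝ × E → E := fun p => if hp : p ∈ V then g ⟨p, hp⟩ else 0
  have hF : ∀ v : V, F v = g v := fun v => by simp [F]
  refine ⟨F, q, fun p hp => ?_, fun p hp => ?_, fun x hx => ?_, fun x hx => ?_⟩
  · refine ContDiffAt.contDiffWithinAt (contMDiffAt_iff_contDiffAt.mp ?_)
    refine (contMDiffAt_subtype_iff (U := V) (x := ⟨p, hp⟩)).mp ?_
    simp only [hF]
    exact g.contMDiff _
  · rw [hF ⟨p, hp⟩]
    exact (hδ _ (hHU ⟨p, hp⟩)).2 (hg _)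
  · have hp : ((0 : ℝ), x) ∈ V := ⟨mem_univ _, hx⟩
    rw [hF ⟨_, hp⟩, hgS (Or.inl le_rfl), hH0 _ (by norm_num)]
  · have hp : ((1 : ℝ), x) ∈ V := ⟨mem_univ _, hx⟩
    rw [hF ⟨_, hp⟩, hgS (Or.inr le_rfl), hH1 _ (by norm_num)]

theorem hasFDerivAt_intervalIntegral_of_contDiffOn {E G : Type} [NormedAddCommGroup E]
    [NormedSpace ℝ E] [FiniteDimensional ℝ E] [NormedAddCommGroup G] [NormedSpace ℝ G]
    {U : Set E} (hU : IsOpen U) {φ : ℝ × E → G} (hφ : ContDiffOn ℝ ∞ φ (univ ×ˢ U))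
    {x : E} (hx : x ∈ U) :
    HasFDerivAt (fun y => ∫ t in (0 : ℝ)..1, φ (t, y))
      (∫ t in (0 : ℝ)..1, (fderiv ℝ φ (t, x)).comp (.inr ℝ ℝ E)) x := by
  have hV : IsOpen ((univ : Set ℝ) ×ˢ U) := isOpen_univ.prod hU
  have hφ' : ContinuousOn (fderiv ℝ φ) (univ ×ˢ U) :=
    hφ.continuousOn_fderiv_of_isOpen hV (by simp)
  have slice : ∀ {G' : Type} [NormedAddCommGroup G'] {ψ : ℝ × E → G'},
      ContinuousOn ψ (univ ×ˢ U) → ∀ y ∈ U, Continuous fun t : ℝ => ψ (t, y) :=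
    fun hψ y hy => hψ.comp_continuous (by fun_prop) fun t => ⟨mem_univ _, hy⟩
  have hφ'' : ContinuousOn (fun p => (fderiv ℝ φ p).comp (.inr ℝ ℝ E)) (univ ×ˢ U) :=
    hφ'.clm_comp continuousOn_const
  obtain ⟨r, hr, hrU⟩ := nhds_basis_closedBall.mem_iff.mp (hU.mem_nhds hx)
  obtain ⟨C, hC⟩ := (isCompact_Icc (a := (0 : ℝ)) (b := 1)).prod
    (isCompact_closedBall x r) |>.exists_bound_of_continuousOn
    (hφ''.mono (prod_mono (subset_univ _) hrU))
  refine intervalIntegral.hasFDerivAt_integral_of_dominated_of_fderiv_le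
    (F := fun y t => φ (t, y)) (F' := fun y t => (fderiv ℝ φ (t, y)).comp (.inr ℝ ℝ E))
    (bound := fun _ => C)
    (closedBall_mem_nhds x hr) ?_ ?_ ?_ ?_ ?_ ?_
  · filter_upwards [hU.mem_nhds hx] with y hy
    exact (slice hφ.continuousOn y hy).aestronglyMeasurable
  · exact (slice hφ.continuousOn x hx).intervalIntegrable _ _
  · exact (slice hφ'' x hx).aestronglyMeasurable
  · refine Filter.Eventually.of_forall fun t ht y hy => hC (t, y) ⟨?_, hy⟩
    rw [uIoc_of_le zero_le_one] at ht
    exact ⟨ht.1.le, ht.2⟩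
  · exact intervalIntegrable_const
  · refine Filter.Eventually.of_forall fun t _ y hy => ?_
    have h1 : HasFDerivAt φ (fderiv ℝ φ (t, y)) (t, y) :=
      ((hφ.contDiffAt (hV.mem_nhds ⟨mem_univ _, hrU hy⟩)).differentiableAt (by simp)).hasFDerivAt
    exact h1.comp y (hasFDerivAt_prodMk_right t y)

theorem contDiffOn_intervalIntegral {E G : Type} [NormedAddCommGroup E]
    [NormedSpace ℝ E] [FiniteDimensional ℝ E] [NormedAddCommGroup G] [NormedSpace ℝ G]
    {U : Set E} (hU : IsOpen U) {φ : ℝ × E → G} (hφ : ContDiffOn ℝ ∞ φ (univ ×ˢ U)) :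
    ContDiffOn ℝ ∞ (fun y => ∫ t in (0 : ℝ)..1, φ (t, y)) U := by
  rw [contDiffOn_infty]
  intro n
  induction n generalizing G with
  | zero =>
    exact contDiffOn_zero.mpr fun x hx =>
      (hasFDerivAt_intervalIntegral_of_contDiffOn hU hφ hx).continuousAt.continuousWithinAt
  | succ n ih =>
    rw [Nat.cast_succ, contDiffOn_succ_iff_hasFDerivWithinAt_of_uniqueDiffOn hU.uniqueDiffOn]
    refine ⟨by simp, _, ih (φ := fun p => (fderiv ℝ φ p).comp (.inr ℝ ℝ E)) ?_, fun x hx =>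
      (hasFDerivAt_intervalIntegral_of_contDiffOn hU hφ hx).hasFDerivWithinAt⟩
    exact (hφ.fderiv_of_isOpen (isOpen_univ.prod hU) (by simp)).clm_comp contDiffOn_const

theorem fderiv_intervalIntegral_apply {E G : Type} [NormedAddCommGroup E]
    [NormedSpace ℝ E] [FiniteDimensional ℝ E] [NormedAddCommGroup G] [NormedSpace ℝ G]
    {U : Set E} (hU : IsOpen U) {φ : ℝ × E → G} (hφ : ContDiffOn ℝ ∞ φ (univ ×ˢ U))
    {x : E} (hx : x ∈ U) (v : E) :
    fderiv ℝ (fun y => ∫ t in (0 : ℝ)..1, φ (t, y)) x v =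
      ∫ t in (0 : ℝ)..1, fderiv ℝ φ (t, x) (0, v) := by
  have hInt : IntervalIntegrable (fun t : ℝ => (fderiv ℝ φ (t, x)).comp (.inr ℝ ℝ E))
      MeasureTheory.volume 0 1 := by
    refine Continuous.intervalIntegrable (Continuous.clm_comp ?_ continuous_const) _ _
    exact (hφ.continuousOn_fderiv_of_isOpen (isOpen_univ.prod hU) (by simp)).comp_continuous
      (by fun_prop) fun t => ⟨mem_univ _, hx⟩
  rw [(hasFDerivAt_intervalIntegral_of_contDiffOn hU hφ hx).fderiv,
    ContinuousLinearMap.intervalIntegral_apply hInt]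
  simp

theorem intervalIntegral_fderiv_eq_sub {E : Type*} [NormedAddCommGroup E] [NormedSpace ℝ E]
    {U : Set E} (hU : IsOpen U) {ψ : ℝ × E → ℝ} (hψ : ContDiffOn ℝ ∞ ψ (univ ×ˢ U))
    {x : E} (hx : x ∈ U) :
    ∫ t in (0 : ℝ)..1, fderiv ℝ ψ (t, x) (1, 0) = ψ (1, x) - ψ (0, x) := by
  have hV : IsOpen ((univ : Set ℝ) ×ˢ U) := isOpen_univ.prod hU
  refine intervalIntegral.integral_eq_sub_of_hasDerivAt (f := fun t => ψ (t, x))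
    (fun t _ => ?_) ?_
  · have h1 : HasFDerivAt ψ (fderiv ℝ ψ (t, x)) (t, x) :=
      ((hψ.contDiffAt (hV.mem_nhds ⟨mem_univ _, hx⟩)).differentiableAt (by simp)).hasFDerivAt
    exact h1.comp_hasDerivAt t ((hasDerivAt_id t).prodMk (hasDerivAt_const t x))
  · refine Continuous.intervalIntegrable ?_ _ _
    refine Continuous.clm_apply ?_ continuous_const
    exact (hψ.continuousOn_fderiv_of_isOpen hV (by simp)).comp_continuous (by fun_prop)
      fun t => ⟨mem_univ _, hx⟩

theorem fderiv_apply_inr_of_eqOn {E G : Type*} [NormedAddCommGroup E] [NormedSpace ℝ E]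
    [NormedAddCommGroup G] [NormedSpace ℝ G] {U : Set E} (hU : IsOpen U) {F : ℝ × E → G}
    (hF : ContDiffOn ℝ ∞ F (univ ×ˢ U)) {t : ℝ} {f : E → G} {f' : E →L[ℝ] G} {x : E}
    (hx : x ∈ U) (h : ∀ y ∈ U, F (t, y) = f y) (hf : HasFDerivAt f f' x) (v : E) :
    fderiv ℝ F (t, x) (0, v) = f' v := by
  have dF : HasFDerivAt (fun y => F (t, y)) ((fderiv ℝ F (t, x)).comp (.inr ℝ ℝ E)) x :=
    (((hF.contDiffAt ((isOpen_univ.prod hU).mem_nhds ⟨mem_univ _, hx⟩)).differentiableAt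
      (by simp)).hasFDerivAt).comp x (hasFDerivAt_prodMk_right t x)
  have := dF.unique (hf.congr_of_eventuallyEq (Filter.eventuallyEq_of_mem (hU.mem_nhds hx) h))
  simpa using congr($this v)

theorem ContDiffOn.isSymmSndFDerivAt_of_isOpen {E G : Type*} [NormedAddCommGroup E]
    [NormedSpace ℝ E] [NormedAddCommGroup G] [NormedSpace ℝ G] {U : Set E} {f : E → G}
    (hf : ContDiffOn ℝ ∞ f U) (hU : IsOpen U) {x : E} (hx : x ∈ U) : IsSymmSndFDerivAt ℝ f x :=
  (hf.contDiffAt (hU.mem_nhds hx)).isSymmSndFDerivAt (by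
    rw [minSmoothness_of_isRCLikeNormedField]; exact ENat.LEInfty.out)

theorem ContDiffOn.hasFDerivAt_of_isOpen {E G : Type*} [NormedAddCommGroup E]
    [NormedSpace ℝ E] [NormedAddCommGroup G] [NormedSpace ℝ G] {U : Set E} {f : E → G}
    (hf : ContDiffOn ℝ ∞ f U) (hU : IsOpen U) {x : E} (hx : x ∈ U) :
    HasFDerivAt f (fderiv ℝ f x) x :=
  ((hf.contDiffAt (hU.mem_nhds hx)).differentiableAt (by simp)).hasFDerivAt

/-- The Poincaré lemma for `1`-forms on a contractible open set. -/
theorem exists_primitive_oneForm {E : Type} [NormedAddCommGroup E] [NormedSpace ℝ E]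
    [FiniteDimensional ℝ E] {U : Set E} (hU : IsOpen U) (hUc : ContractibleSpace U)
    {θ : E → E →L[ℝ] ℝ} (hθ : ContDiffOn ℝ ∞ θ U)
    (hclosed : ∀ x ∈ U, ∀ v w, fderiv ℝ θ x v w = fderiv ℝ θ x w v) :
    ∃ f : E → ℝ, ContDiffOn ℝ ∞ f U ∧ ∀ x ∈ U, fderiv ℝ f x = θ x := by
  obtain ⟨F, q, hF, hFU, hF0, hF1⟩ := exists_contDiffOn_contraction hU hUc
  have hV : IsOpen ((univ : Set ℝ) ×ˢ U) := isOpen_univ.prod hU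
  have hA : ContDiffOn ℝ ∞ (fderiv ℝ F) (univ ×ˢ U) := hF.fderiv_of_isOpen hV (by simp)
  have hΘ : ∀ u, ContDiffOn ℝ ∞ (fun p => θ (F p) (fderiv ℝ F p u)) (univ ×ˢ U) := fun u =>
    (hθ.comp hF hFU).clm_apply (hA.clm_apply contDiffOn_const)
  have key : ∀ p ∈ (univ : Set ℝ) ×ˢ U, ∀ u z,
      fderiv ℝ (fun p => θ (F p) (fderiv ℝ F p u)) p z =
        fderiv ℝ θ (F p) (fderiv ℝ F p z) (fderiv ℝ F p u) +
          θ (F p) (fderiv ℝ (fderiv ℝ F) p z u) := fun p hp u z => by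
    have := (((hθ.hasFDerivAt_of_isOpen hU (hFU hp)).comp p
      (hF.hasFDerivAt_of_isOpen hV hp)).clm_apply
        ((hA.hasFDerivAt_of_isOpen hV hp).clm_apply (hasFDerivAt_const u p))).fderiv
    refine congr($this z).trans ?_
    simp [add_comm]
  refine ⟨fun x => -∫ t in (0 : ℝ)..1, θ (F (t, x)) (fderiv ℝ F (t, x) (1, 0)),
    (contDiffOn_intervalIntegral hU (hΘ _)).neg, fun x hx => ?_⟩
  rw [fderiv_fun_neg]
  ext v
  rw [neg_apply, fderiv_intervalIntegral_apply hU (hΘ (1, 0)) hx]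
  have swap : ∀ t : ℝ, fderiv ℝ (fun p => θ (F p) (fderiv ℝ F p (1, 0))) (t, x) (0, v) =
      fderiv ℝ (fun p => θ (F p) (fderiv ℝ F p (0, v))) (t, x) (1, 0) := fun t => by
    have hp : (t, x) ∈ (univ : Set ℝ) ×ˢ U := ⟨mem_univ _, hx⟩
    rw [key _ hp, key _ hp, hclosed _ (hFU hp), (hF.isSymmSndFDerivAt_of_isOpen hV hp).eq]
  simp only [swap]
  rw [intervalIntegral_fderiv_eq_sub hU (hΘ _) hx,
    fderiv_apply_inr_of_eqOn hU hF hx hF0 (hasFDerivAt_id x),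
    fderiv_apply_inr_of_eqOn hU hF hx hF1 (hasFDerivAt_const q x), hF0 x hx]
  simp

/-- The Poincaré lemma for `2`-forms on a contractible open set. -/
theorem exists_primitive_twoForm {E : Type} [NormedAddCommGroup E] [NormedSpace ℝ E]
    [FiniteDimensional ℝ E] {U : Set E} (hU : IsOpen U) (hUc : ContractibleSpace U)
    {σ : E → E →L[ℝ] E →L[ℝ] ℝ} (hσ : ContDiffOn ℝ ∞ σ U)
    (halt : ∀ x ∈ U, ∀ v w, σ x v w = -σ x w v)
    (hclosed : ∀ x ∈ U, ∀ u v w,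
      fderiv ℝ σ x u v w - fderiv ℝ σ x v u w + fderiv ℝ σ x w u v = 0) :
    ∃ β : E → E →L[ℝ] ℝ, ContDiffOn ℝ ∞ β U ∧
      ∀ x ∈ U, ∀ v w, fderiv ℝ β x v w - fderiv ℝ β x w v = σ x v w := by
  obtain ⟨F, q, hF, hFU, hF0, hF1⟩ := exists_contDiffOn_contraction hU hUc
  have hV : IsOpen ((univ : Set ℝ) ×ˢ U) := isOpen_univ.prod hU
  have hA : ContDiffOn ℝ ∞ (fderiv ℝ F) (univ ×ˢ U) := hF.fderiv_of_isOpen hV (by simp)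
  have hσA : ∀ u, ContDiffOn ℝ ∞ (fun p => σ (F p) (fderiv ℝ F p u)) (univ ×ˢ U) := fun u =>
    (hσ.comp hF hFU).clm_apply (hA.clm_apply contDiffOn_const)
  have hΩ : ∀ u v, ContDiffOn ℝ ∞ (fun p => σ (F p) (fderiv ℝ F p u) (fderiv ℝ F p v))
      (univ ×ˢ U) := fun u v => (hσA u).clm_apply (hA.clm_apply contDiffOn_const)
  have hφ : ContDiffOn ℝ ∞ (fun p => (σ (F p) (fderiv ℝ F p (1, 0))).comp
      ((fderiv ℝ F p).comp (.inr ℝ ℝ E))) (univ ×ˢ U) :=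
    (hσA _).clm_comp (hA.clm_comp contDiffOn_const)
  have key : ∀ p ∈ (univ : Set ℝ) ×ˢ U, ∀ u v z,
      fderiv ℝ (fun p => σ (F p) (fderiv ℝ F p u) (fderiv ℝ F p v)) p z =
        fderiv ℝ σ (F p) (fderiv ℝ F p z) (fderiv ℝ F p u) (fderiv ℝ F p v) +
          σ (F p) (fderiv ℝ (fderiv ℝ F) p z u) (fderiv ℝ F p v) +
          σ (F p) (fderiv ℝ F p u) (fderiv ℝ (fderiv ℝ F) p z v) := fun p hp u v z => by
    have hA' := hA.hasFDerivAt_of_isOpen hV hp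
    have := ((((hσ.hasFDerivAt_of_isOpen hU (hFU hp)).comp p
      (hF.hasFDerivAt_of_isOpen hV hp)).clm_apply
        (hA'.clm_apply (hasFDerivAt_const u p))).clm_apply
          (hA'.clm_apply (hasFDerivAt_const v p))).fderiv
    refine congr($this z).trans ?_
    simp
    ring
  have hβ : ∀ x ∈ U, ∀ v w, fderiv ℝ (fun x => -∫ t in (0 : ℝ)..1,
      (σ (F (t, x)) (fderiv ℝ F (t, x) (1, 0))).comp ((fderiv ℝ F (t, x)).comp (.inr ℝ ℝ E)))
        x v w = -∫ t in (0 : ℝ)..1, fderiv ℝ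
          (fun p => σ (F p) (fderiv ℝ F p (1, 0)) (fderiv ℝ F p (0, w))) (t, x) (0, v) := by
    intro x hx v w
    have hc : Continuous fun t : ℝ => fderiv ℝ (fun p => (σ (F p) (fderiv ℝ F p (1, 0))).comp
        ((fderiv ℝ F p).comp (.inr ℝ ℝ E))) (t, x) (0, v) :=
      ((hφ.continuousOn_fderiv_of_isOpen hV (by simp)).comp_continuous
        (by fun_prop) fun t => ⟨mem_univ _, hx⟩).clm_apply continuous_const
    rw [fderiv_fun_neg, neg_apply, fderiv_intervalIntegral_apply hU hφ hx,
      neg_apply,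
      ContinuousLinearMap.intervalIntegral_apply (hc.intervalIntegrable _ _)]
    congr 2
    ext t
    have := ((hφ.hasFDerivAt_of_isOpen hV (x := (t, x)) ⟨mem_univ _, hx⟩).clm_apply
      (hasFDerivAt_const w _)).fderiv
    have := congr($this (0, v))
    simpa using this.symm
  refine ⟨_, (contDiffOn_intervalIntegral hU hφ).neg, fun x hx v w => ?_⟩
  have hInt : ∀ u v z, IntervalIntegrable (fun t : ℝ => fderiv ℝ
      (fun p => σ (F p) (fderiv ℝ F p u) (fderiv ℝ F p v)) (t, x) z)
      MeasureTheory.volume 0 1 := fun u v z =>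
    ((((hΩ u v).continuousOn_fderiv_of_isOpen hV (by simp)).comp_continuous
      (by fun_prop) fun t => ⟨mem_univ _, hx⟩).clm_apply continuous_const).intervalIntegrable _ _
  have cyc : ∀ t : ℝ,
      fderiv ℝ (fun p => σ (F p) (fderiv ℝ F p (1, 0)) (fderiv ℝ F p (0, w))) (t, x) (0, v) -
      fderiv ℝ (fun p => σ (F p) (fderiv ℝ F p (1, 0)) (fderiv ℝ F p (0, v))) (t, x) (0, w) =
      fderiv ℝ (fun p => σ (F p) (fderiv ℝ F p (0, v)) (fderiv ℝ F p (0, w))) (t, x) (1, 0) :=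
    fun t => by
      have hp : (t, x) ∈ (univ : Set ℝ) ×ˢ U := ⟨mem_univ _, hx⟩
      have sym := fun u v => (hF.isSymmSndFDerivAt_of_isOpen hV hp).eq u v
      rw [key _ hp, key _ hp, key _ hp, sym (0, v) (1, 0), sym (0, w) (1, 0), sym (0, w) (0, v),
        halt _ (hFU hp) (fderiv ℝ F (t, x) (0, v)) (fderiv ℝ (fderiv ℝ F) (t, x) (1, 0) (0, w))]
      linear_combination -hclosed _ (hFU hp) (fderiv ℝ F (t, x) (1, 0))
        (fderiv ℝ F (t, x) (0, v)) (fderiv ℝ F (t, x) (0, w))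
  refine (congrArg₂ (· - ·) (hβ x hx v w) (hβ x hx w v)).trans ?_
  rw [neg_sub_neg, ← neg_sub, ← intervalIntegral.integral_sub (hInt _ _ _) (hInt _ _ _)]
  simp only [cyc]
  rw [intervalIntegral_fderiv_eq_sub hU (hΩ _ _) hx,
    fderiv_apply_inr_of_eqOn hU hF hx hF0 (hasFDerivAt_id x),
    fderiv_apply_inr_of_eqOn hU hF hx hF0 (hasFDerivAt_id x),
    fderiv_apply_inr_of_eqOn hU hF hx hF1 (hasFDerivAt_const q x), hF0 x hx]
  simp

/-- The partial derivative `∂f/∂xᵢ` on `ℝ³`. -/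
noncomputable def pderiv (i : Fin 3) (f : (Fin 3 → ℝ) → ℝ) : (Fin 3 → ℝ) → ℝ :=
  fun p => fderiv ℝ f p (Pi.single i 1)

theorem fderiv_apply_eq_pderiv (f : (Fin 3 → ℝ) → ℝ) (p v : Fin 3 → ℝ) :
    fderiv ℝ f p v = v 0 * pderiv 0 f p + v 1 * pderiv 1 f p + v 2 * pderiv 2 f p := by
  conv_lhs => rw [pi_eq_sum_univ' v]
  simp [Fin.sum_univ_three, pderiv]

theorem opX_eq (f : (Fin 3 → ℝ) → ℝ) (p : Fin 3 → ℝ) : opX f p = pderiv 0 f p := by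
  simp [opX, fderiv_apply_eq_pderiv]

theorem opY_eq (f : (Fin 3 → ℝ) → ℝ) (p : Fin 3 → ℝ) :
    opY f p = p 0 ^ 2 * pderiv 1 f p + pderiv 2 f p := by
  simp [opY, fderiv_apply_eq_pderiv]

theorem opZ_eq (f : (Fin 3 → ℝ) → ℝ) (p : Fin 3 → ℝ) : opZ f p = 2 * p 0 * pderiv 1 f p := by
  simp [opZ, fderiv_apply_eq_pderiv]

theorem opW_eq (f : (Fin 3 → ℝ) → ℝ) (p : Fin 3 → ℝ) : opW f p = 2 * pderiv 1 f p := by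
  simp [opW, fderiv_apply_eq_pderiv]

section pderiv

variable {i : Fin 3} {f g : (Fin 3 → ℝ) → ℝ} {p : Fin 3 → ℝ} {U : Set (Fin 3 → ℝ)}

theorem pderiv_add (hf : DifferentiableAt ℝ f p) (hg : DifferentiableAt ℝ g p) :
    pderiv i (fun q => f q + g q) p = pderiv i f p + pderiv i g p := by
  simp [pderiv, fderiv_fun_add hf hg]

theorem pderiv_sub (hf : DifferentiableAt ℝ f p) (hg : DifferentiableAt ℝ g p) :
    pderiv i (fun q => f q - g q) p = pderiv i f p - pderiv i g p := by
  simp [pderiv, fderiv_fun_sub hf hg]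

theorem pderiv_neg : pderiv i (fun q => -f q) p = -pderiv i f p := by
  simp [pderiv, fderiv_fun_neg]

theorem pderiv_mul (hf : DifferentiableAt ℝ f p) (hg : DifferentiableAt ℝ g p) :
    pderiv i (fun q => f q * g q) p = pderiv i f p * g p + f p * pderiv i g p := by
  simp [pderiv, fderiv_fun_mul hf hg]
  ring

theorem pderiv_const (r : ℝ) : pderiv i (fun _ => r) p = 0 := by
  simp [pderiv]

theorem pderiv_coord_zero : pderiv i (fun q => q 0) p = if i = 0 then 1 else 0 := by
  have : fderiv ℝ (fun q : Fin 3 → ℝ => q 0) p = .proj 0 :=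
    (ContinuousLinearMap.proj (R := ℝ) (φ := fun _ : Fin 3 => ℝ) 0).fderiv
  simp [pderiv, this, Pi.single_apply, eq_comm]

theorem pderiv_congr (hU : IsOpen U) (h : ∀ q ∈ U, f q = g q) (hp : p ∈ U) :
    pderiv i f p = pderiv i g p := by
  simp only [pderiv, (Filter.eventuallyEq_of_mem (hU.mem_nhds hp) h).fderiv_eq]

theorem contDiffOn_pderiv (hU : IsOpen U) (hf : ContDiffOn ℝ ∞ f U) :
    ContDiffOn ℝ ∞ (pderiv i f) U :=
  (hf.fderiv_of_isOpen hU (by simp)).clm_apply contDiffOn_const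

end pderiv

theorem exists_potential {U : Set (Fin 3 → ℝ)} (hU : IsOpen U) (hUc : ContractibleSpace U)
    {θ : Fin 3 → (Fin 3 → ℝ) → ℝ} (hθ : ∀ i, ContDiffOn ℝ ∞ (θ i) U)
    (h01 : ∀ p ∈ U, pderiv 0 (θ 1) p = pderiv 1 (θ 0) p)
    (h02 : ∀ p ∈ U, pderiv 0 (θ 2) p = pderiv 2 (θ 0) p)
    (h12 : ∀ p ∈ U, pderiv 1 (θ 2) p = pderiv 2 (θ 1) p) :
    ∃ f : (Fin 3 → ℝ) → ℝ, ContDiffOn ℝ ∞ f U ∧ ∀ i, ∀ p ∈ U, pderiv i f p = θ i p := by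
  let e (i : Fin 3) : (Fin 3 → ℝ) →L[ℝ] ℝ := .proj i
  have hsm : ContDiffOn ℝ ∞ (fun p => θ 0 p • e 0 + θ 1 p • e 1 + θ 2 p • e 2) U :=
    (((hθ 0).smul contDiffOn_const).add ((hθ 1).smul contDiffOn_const)).add
      ((hθ 2).smul contDiffOn_const)
  obtain ⟨f, hf, hf'⟩ := exists_primitive_oneForm hU hUc hsm fun p hp v w => by
    have hd := fun i => (hθ i).hasFDerivAt_of_isOpen hU hp
    rw [((((hd 0).smul_const (e 0)).fun_add ((hd 1).smul_const (e 1))).fun_add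
      ((hd 2).smul_const (e 2))).fderiv]
    simp [e, fderiv_apply_eq_pderiv]
    linear_combination (v 0 * w 1 - v 1 * w 0) * h01 p hp + (v 0 * w 2 - v 2 * w 0) * h02 p hp +
      (v 1 * w 2 - v 2 * w 1) * h12 p hp
  refine ⟨f, hf, fun i p hp => ?_⟩
  rw [pderiv, hf' p hp]
  fin_cases i <;> simp [e]

set_option maxSynthPendingDepth 5 in
theorem exists_vectorPotential {U : Set (Fin 3 → ℝ)} (hU : IsOpen U) (hUc : ContractibleSpace U)
    {P Q R : (Fin 3 → ℝ) → ℝ} (hP : ContDiffOn ℝ ∞ P U) (hQ : ContDiffOn ℝ ∞ Q U)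
    (hR : ContDiffOn ℝ ∞ R U)
    (hdiv : ∀ p ∈ U, pderiv 0 P p - pderiv 1 Q p + pderiv 2 R p = 0) :
    ∃ β : Fin 3 → (Fin 3 → ℝ) → ℝ, (∀ i, ContDiffOn ℝ ∞ (β i) U) ∧ ∀ p ∈ U,
      pderiv 1 (β 2) p - pderiv 2 (β 1) p = P p ∧
      pderiv 0 (β 2) p - pderiv 2 (β 0) p = Q p ∧
      pderiv 0 (β 1) p - pderiv 1 (β 0) p = R p := by
  let e (i j : Fin 3) : (Fin 3 → ℝ) →L[ℝ] (Fin 3 → ℝ) →L[ℝ] ℝ :=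
    (ContinuousLinearMap.proj i).smulRight (.proj j) -
      (ContinuousLinearMap.proj j).smulRight (.proj i)
  have hsm : ContDiffOn ℝ ∞ (fun p => P p • e 1 2 + Q p • e 0 2 + R p • e 0 1) U :=
    ((hP.smul contDiffOn_const).add (hQ.smul contDiffOn_const)).add (hR.smul contDiffOn_const)
  obtain ⟨β, hβ, hβ'⟩ := exists_primitive_twoForm hU hUc hsm
    (fun p _ v w => by simp [e]; ring) fun p hp u v w => by
      rw [((((hP.hasFDerivAt_of_isOpen hU hp).smul_const (e 1 2)).fun_add
        ((hQ.hasFDerivAt_of_isOpen hU hp).smul_const (e 0 2))).fun_add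
        ((hR.hasFDerivAt_of_isOpen hU hp).smul_const (e 0 1))).fderiv]
      simp [e, fderiv_apply_eq_pderiv]
      linear_combination (u 0 * (v 1 * w 2 - v 2 * w 1) - u 1 * (v 0 * w 2 - v 2 * w 0) +
        u 2 * (v 0 * w 1 - v 1 * w 0)) * hdiv p hp
  have hcoord : ∀ p ∈ U, ∀ i j, pderiv i (fun q => β q (Pi.single j 1)) p =
      fderiv ℝ β p (Pi.single i 1) (Pi.single j 1) := fun p hp i j => by
    rw [pderiv, ((hβ.hasFDerivAt_of_isOpen hU hp).clm_apply (hasFDerivAt_const _ p)).fderiv]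
    simp
  refine ⟨fun j q => β q (Pi.single j 1), fun j => hβ.clm_apply contDiffOn_const,
    fun p hp => ?_⟩
  simp only [hcoord p hp, hβ' p hp]
  simp [e]

theorem martinet_exact_degree_two
    (U : Set (Fin 3 → ℝ)) (hU : IsOpen U) (hUc : ContractibleSpace U)
    (c d : (Fin 3 → ℝ) → ℝ)
    (hc : ContDiffOn ℝ (⊤ : ℕ∞) c U) (hd : ContDiffOn ℝ (⊤ : ℕ∞) d U)
    (h1 : ∀ p ∈ U, opX (opX (opX d)) p + (opX (opY c) p + opZ c p) = 0)
    (h2 : ∀ p ∈ U, opY (opY c) p +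
            (opY (opX (opX d)) p - opZ (opX d) p + opW d p) = 0) :
    ∃ a b : (Fin 3 → ℝ) → ℝ, ContDiffOn ℝ (⊤ : ℕ∞) a U ∧ ContDiffOn ℝ (⊤ : ℕ∞) b U ∧
      ∀ p ∈ U,
        c p = opX (opX (opX b)) p -
                (opX (opX (opY a)) p + opX (opZ a) p + opW a p) ∧
        d p = opY (opY a) p - (opY (opX b) p - opZ b p) := by
  have hx : ContDiffOn ℝ ∞ (fun q : Fin 3 → ℝ => q 0) U := (contDiff_apply ℝ ℝ 0).contDiffOn
  have diff : ∀ {f : (Fin 3 → ℝ) → ℝ}, ContDiffOn ℝ ∞ f U → ∀ p ∈ U, DifferentiableAt ℝ f p :=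
    fun hf p hp => (hf.hasFDerivAt_of_isOpen hU hp).differentiableAt
  simp only [funext (opX_eq _), funext (opY_eq _), funext (opZ_eq _), funext (opW_eq _)]
    at h1 h2 ⊢
  obtain ⟨D, hD⟩ : ∃ D, D = pderiv 0 d := ⟨_, rfl⟩
  have hDs : ContDiffOn ℝ ∞ D U := hD ▸ contDiffOn_pderiv hU hd
  have hD0 : ContDiffOn ℝ ∞ (pderiv 0 D) U := contDiffOn_pderiv hU hDs
  have hYc : ContDiffOn ℝ ∞ (fun q => q 0 ^ 2 * pderiv 1 c q + pderiv 2 c q) U :=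
    ((hx.pow 2).mul (contDiffOn_pderiv hU hc)).add (contDiffOn_pderiv hU hc)
  obtain ⟨m, hm⟩ : ∃ m : (Fin 3 → ℝ) → ℝ,
    m = fun q => pderiv 0 D q + (q 0 ^ 2 * pderiv 1 c q + pderiv 2 c q) := ⟨_, rfl⟩
  have hms : ContDiffOn ℝ ∞ m U := hm ▸ hD0.add hYc
  have hm' : ∀ i, ∀ p ∈ U, pderiv i m p = pderiv i (pderiv 0 D) p +
      pderiv i (fun q => q 0 ^ 2 * pderiv 1 c q + pderiv 2 c q) p := fun i p hp => by
    rw [hm, pderiv_add (diff hD0 p hp) (diff hYc p hp)]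
  have h1' : ∀ p ∈ U, pderiv 0 m p + 2 * p 0 * pderiv 1 c p = 0 := fun p hp => by
    rw [hm' 0 p hp]
    have := h1 p hp
    rw [← hD] at this
    linear_combination this
  have h2' : ∀ p ∈ U, p 0 ^ 2 * pderiv 1 m p + pderiv 2 m p - 2 * p 0 * pderiv 1 D p +
      2 * pderiv 1 d p = 0 := fun p hp => by
    rw [hm' 1 p hp, hm' 2 p hp]
    have := h2 p hp
    rw [← hD] at this
    linear_combination this
  have hmp : ∀ p, m p = pderiv 0 D p + (p 0 ^ 2 * pderiv 1 c p + pderiv 2 c p) := fun p => by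
    rw [hm]
  have hdp : ∀ p, pderiv 0 d p = D p := fun p => by rw [hD]
  clear h1 h2 hm hD hm' hYc hD0
  obtain ⟨f, hf, hf'⟩ := exists_potential hU hUc
    (θ := ![fun q => -(q 0 * c q), fun q => 1 / 2 * m q,
      fun q => q 0 * D q - d q - 1 / 2 * (q 0 * (q 0 * m q))])
    (fun i => by
      fin_cases i
      · exact (hx.mul hc).neg
      · exact contDiffOn_const.mul hms
      · exact ((hx.mul hDs).sub hd).sub (contDiffOn_const.mul (hx.mul (hx.mul hms))))
    (fun p hp => by
      have dx := diff hx p hp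
      have dc := diff hc p hp
      have dm := diff hms p hp
      simp (disch := fun_prop) [pderiv_neg, pderiv_mul, pderiv_const, pderiv_coord_zero]
      linear_combination 1 / 2 * h1' p hp)
    (fun p hp => by
      have dx := diff hx p hp
      have dc := diff hc p hp
      have dd := diff hd p hp
      have dD := diff hDs p hp
      have dm := diff hms p hp
      simp (disch := fun_prop) [pderiv_neg, pderiv_mul, pderiv_sub, pderiv_const,
        pderiv_coord_zero]
      linear_combination -1 / 2 * p 0 ^ 2 * h1' p hp - p 0 * hmp p - hdp p)
    (fun p hp => by
      have dx := diff hx p hp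
      have dd := diff hd p hp
      have dD := diff hDs p hp
      have dm := diff hms p hp
      simp (disch := fun_prop) [pderiv_mul, pderiv_sub, pderiv_const, pderiv_coord_zero]
      linear_combination -1 / 2 * h2' p hp)
  obtain ⟨β, hβ, hβ'⟩ := exists_vectorPotential hU hUc
    (P := fun q => 1 / 2 * (D q - q 0 * m q)) (Q := fun q => 1 / 2 * (q 0 * (q 0 * c q)))
    (R := fun q => 1 / 2 * c q)
    (contDiffOn_const.mul (hDs.sub (hx.mul hms)))
    (contDiffOn_const.mul (hx.mul (hx.mul hc))) (contDiffOn_const.mul hc) (fun p hp => by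
      have dx := diff hx p hp
      have dc := diff hc p hp
      have dD := diff hDs p hp
      have dm := diff hms p hp
      simp (disch := fun_prop) [pderiv_mul, pderiv_sub, pderiv_const, pderiv_coord_zero]
      linear_combination -1 / 2 * p 0 * h1' p hp - 1 / 2 * hmp p)
  have hf0 := hf' 0
  have hf1 := hf' 1
  have hf2 := hf' 2
  simp only [Matrix.cons_val] at hf0 hf1 hf2
  let b : (Fin 3 → ℝ) → ℝ := fun q => β 2 q + q 0 * (q 0 * β 1 q) + q 0 * f q
  let e : (Fin 3 → ℝ) → ℝ := fun q => f q + 2 * (q 0 * β 1 q)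
  have hb : ContDiffOn ℝ ∞ b U := ((hβ 2).add (hx.mul (hx.mul (hβ 1)))).add (hx.mul hf)
  have hYa : ContDiffOn ℝ ∞ (fun q => q 0 ^ 2 * pderiv 1 (β 0) q + pderiv 2 (β 0) q) U :=
    ((hx.pow 2).mul (contDiffOn_pderiv hU (hβ 0))).add (contDiffOn_pderiv hU (hβ 0))
  have hZa : ContDiffOn ℝ ∞ (fun q => 2 * q 0 * pderiv 1 (β 0) q) U :=
    (contDiffOn_const.mul hx).mul (contDiffOn_pderiv hU (hβ 0))
  have eq_e : ∀ p ∈ U, pderiv 0 b p - (p 0 ^ 2 * pderiv 1 (β 0) p + pderiv 2 (β 0) p) = e p :=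
    fun p hp => by
      have dx := diff hx p hp
      have df := diff hf p hp
      have d1 := diff (hβ 1) p hp
      have d2 := diff (hβ 2) p hp
      simp (disch := fun_prop) [b, e, pderiv_mul, pderiv_add, pderiv_coord_zero, hf0 p hp]
      linear_combination (hβ' p hp).2.1 + p 0 ^ 2 * (hβ' p hp).2.2
  have eq_g : ∀ p ∈ U, pderiv 0 e p - 2 * p 0 * pderiv 1 (β 0) p = 2 * β 1 p :=
    fun p hp => by
      have dx := diff hx p hp
      have df := diff hf p hp
      have d1 := diff (hβ 1) p hp
      simp (disch := fun_prop) [e, pderiv_mul, pderiv_add, pderiv_const, pderiv_coord_zero,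
        hf0 p hp]
      linear_combination 2 * p 0 * (hβ' p hp).2.2
  have he : ContDiffOn ℝ ∞ e U := hf.add (contDiffOn_const.mul (hx.mul (hβ 1)))
  have sub_e : ∀ i, ∀ p ∈ U, pderiv i (pderiv 0 b) p -
      pderiv i (fun q => q 0 ^ 2 * pderiv 1 (β 0) q + pderiv 2 (β 0) q) p = pderiv i e p :=
    fun i p hp => by
      rw [← pderiv_sub (diff (contDiffOn_pderiv hU hb) p hp) (diff hYa p hp)]
      exact pderiv_congr hU eq_e hp
  refine ⟨β 0, b, hβ 0, hb, fun p hp => ⟨?_, ?_⟩⟩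
  · have hXX : pderiv 0 (pderiv 0 (pderiv 0 b)) p - pderiv 0 (pderiv 0
        (fun q => q 0 ^ 2 * pderiv 1 (β 0) q + pderiv 2 (β 0) q)) p = pderiv 0 (pderiv 0 e) p := by
      rw [← pderiv_sub (diff (contDiffOn_pderiv hU (contDiffOn_pderiv hU hb)) p hp)
        (diff (contDiffOn_pderiv hU hYa) p hp)]
      exact pderiv_congr hU (sub_e 0) hp
    have hXe : pderiv 0 (pderiv 0 e) p - pderiv 0 (fun q => 2 * q 0 * pderiv 1 (β 0) q) p =
        2 * pderiv 0 (β 1) p := by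
      rw [← pderiv_sub (diff (contDiffOn_pderiv hU he) p hp) (diff hZa p hp),
        pderiv_congr hU eq_g hp, pderiv_mul (by fun_prop) (diff (hβ 1) p hp), pderiv_const]
      ring
    linear_combination -hXX - hXe - 2 * (hβ' p hp).2.2
  · have dx := diff hx p hp
    have df := diff hf p hp
    have d1 := diff (hβ 1) p hp
    have d2 := diff (hβ 2) p hp
    have e1 := sub_e 1 p hp
    have e2 := sub_e 2 p hp
    simp (disch := fun_prop) [e, pderiv_mul, pderiv_add, pderiv_const, pderiv_coord_zero,
      hf1 p hp, hf2 p hp] at e1 e2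
    have hb1 : pderiv 1 b p = pderiv 1 (β 2) p + p 0 ^ 2 * pderiv 1 (β 1) p +
        p 0 * (1 / 2 * m p) := by
      simp (disch := fun_prop) [b, pderiv_mul, pderiv_add, pderiv_coord_zero, hf1 p hp]
      ring
    linear_combination p 0 ^ 2 * e1 + e2 - 2 * p 0 * hb1 - 2 * p 0 * (hβ' p hp).1
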